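/- Let (g, Φ = (D, θ), ⟨·,·⟩) be an extrinsic symmetric triple with n = dim g₋⁻ ≥ 1, let h be its mean curvature vector and A the shape operator. Then for every η ∈ g₋⁺ the operators A_h and A_η on g₋⁻ commute: A_h ∘ A_η = A_η ∘ A_h. -/

import Mathlib

/-- The span of all brackets `⁅u, v⁆` with `u ∈ U`, `v ∈ V`. -/
def bracketSpan {L : Type} [LieRing L] [LieAlgebra ℝ L]
    (U V : Submodule ℝ L) : Submodule ℝ L :=
  Submodule.span ℝ {z | ∃ u ∈ U, ∃ v ∈ V, z = ⁅u, v⁆}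

/-- An extrinsic symmetric triple `(g, (D, θ), ⟨·,·⟩)`: a metric Lie algebra with an
invariant nondegenerate symmetric bilinear form, an isometric involutive automorphism `θ`,
and an antisymmetric derivation `D` with `D³ = -D`, `Dθ = -θD` and `g₊⁺ = [g₊⁻, g₊⁻]`. -/
structure ExtSymTriple (L : Type) [LieRing L] [LieAlgebra ℝ L] [Module.Finite ℝ L] where
  B : LinearMap.BilinForm ℝ L
  Bsymm : ∀ x y, B x y = B y x
  Binv : ∀ x y z, B ⁅x, y⁆ z = B x ⁅y, z⁆
  Bnondeg : B.Nondegenerate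
  theta : L →ₗ[ℝ] L
  thetaLie : ∀ x y, theta ⁅x, y⁆ = ⁅theta x, theta y⁆
  thetaInvol : ∀ x, theta (theta x) = x
  thetaIso : ∀ x y, B (theta x) (theta y) = B x y
  D : L →ₗ[ℝ] L
  Dder : ∀ x y, D ⁅x, y⁆ = ⁅D x, y⁆ + ⁅x, D y⁆
  Danti : ∀ x y, B (D x) y = - B x (D y)
  D3 : ∀ x, D (D (D x)) = - D x
  Dtheta : ∀ x, D (theta x) = - theta (D x)
  cartan : (LinearMap.ker (theta - LinearMap.id) ⊓ LinearMap.ker D) =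
    bracketSpan
      (LinearMap.ker (theta - LinearMap.id) ⊓ LinearMap.ker (D ∘ₗ D + LinearMap.id))
      (LinearMap.ker (theta - LinearMap.id) ⊓ LinearMap.ker (D ∘ₗ D + LinearMap.id))

namespace ExtSymTriple

variable {L : Type} [LieRing L] [LieAlgebra ℝ L] [Module.Finite ℝ L] (T : ExtSymTriple L)

/-- `g₊⁺ = g₊ ∩ g⁺`. -/
def gPlusUp : Submodule ℝ L :=
  LinearMap.ker (T.theta - LinearMap.id) ⊓ LinearMap.ker T.D

/-- `g₊⁻ = g₊ ∩ g⁻`. -/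
def gPlusDown : Submodule ℝ L :=
  LinearMap.ker (T.theta - LinearMap.id) ⊓ LinearMap.ker (T.D ∘ₗ T.D + LinearMap.id)

/-- `g₋⁺ = g₋ ∩ g⁺`. -/
def gMinusUp : Submodule ℝ L :=
  LinearMap.ker (T.theta + LinearMap.id) ⊓ LinearMap.ker T.D

/-- `g₋⁻ = g₋ ∩ g⁻`. -/
def gMinusDown : Submodule ℝ L :=
  LinearMap.ker (T.theta + LinearMap.id) ⊓ LinearMap.ker (T.D ∘ₗ T.D + LinearMap.id)

/-- Indecomposability: `g` is not the direct sum of two nonzero ideals that are orthogonal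
to each other and invariant under `θ` and `D`. -/
def Indecomposable : Prop :=
  ¬ ∃ I J : LieIdeal ℝ L, I ≠ ⊥ ∧ J ≠ ⊥ ∧
    (I : Submodule ℝ L) ⊓ (J : Submodule ℝ L) = ⊥ ∧
    (I : Submodule ℝ L) ⊔ (J : Submodule ℝ L) = ⊤ ∧
    (∀ x ∈ I, ∀ y ∈ J, T.B x y = 0) ∧
    (∀ x ∈ I, T.theta x ∈ I) ∧ (∀ x ∈ I, T.D x ∈ I) ∧
    (∀ x ∈ J, T.theta x ∈ J) ∧ (∀ x ∈ J, T.D x ∈ J)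

end ExtSymTriple

namespace ExtSymTriple

variable {L : Type} [LieRing L] [LieAlgebra ℝ L] [Module.Finite ℝ L] (T : ExtSymTriple L)

theorem mem_gPlusUp {x : L} : x ∈ T.gPlusUp ↔ T.theta x = x ∧ T.D x = 0 := by
  simp [gPlusUp, sub_eq_zero]

theorem mem_gMinusUp {x : L} : x ∈ T.gMinusUp ↔ T.theta x = -x ∧ T.D x = 0 := by
  simp [gMinusUp, eq_neg_iff_add_eq_zero]

theorem mem_gMinusDown {x : L} :
    x ∈ T.gMinusDown ↔ T.theta x = -x ∧ T.D (T.D x) = -x := by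
  simp [gMinusDown, eq_neg_iff_add_eq_zero]

theorem D_lie_of_D_eq_zero {x : L} (hx : T.D x = 0) (y : L) : T.D ⁅x, y⁆ = ⁅x, T.D y⁆ := by
  simp [T.Dder, hx]

theorem lie_mem_gMinusDown {x u : L} (hx : x ∈ T.gPlusUp) (hu : u ∈ T.gMinusDown) :
    ⁅x, u⁆ ∈ T.gMinusDown := by
  rw [mem_gPlusUp] at hx
  rw [mem_gMinusDown] at hu ⊢
  simp [T.thetaLie, T.D_lie_of_D_eq_zero hx.2, hx.1, hu.1, hu.2]

theorem lie_mem_gPlusUp {x y : L} (hx : x ∈ T.gMinusUp) (hy : y ∈ T.gMinusUp) :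
    ⁅x, y⁆ ∈ T.gPlusUp := by
  rw [mem_gMinusUp] at hx hy
  rw [mem_gPlusUp]
  simp [T.thetaLie, T.Dder, hx.1, hx.2, hy.1, hy.2]

theorem lie_D_self_mem_gMinusUp {u : L} (hu : u ∈ T.gMinusDown) :
    ⁅T.D u, u⁆ ∈ T.gMinusUp := by
  rw [mem_gMinusDown] at hu
  have hθ : T.theta (T.D u) = T.D u := by
    have := T.Dtheta u
    rw [hu.1, map_neg] at this
    exact (neg_injective this).symm
  rw [mem_gMinusUp]
  simp [T.thetaLie, T.Dder, hθ, hu.1, hu.2]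

/-- The form is nondegenerate on `g₊⁺`. -/
theorem eq_zero_of_orthogonal_gPlusUp {y : L} (hy : y ∈ T.gPlusUp)
    (h : ∀ x ∈ T.gPlusUp, T.B y x = 0) : y = 0 := by
  refine T.Bnondeg.1 y fun z => ?_
  rw [mem_gPlusUp] at hy
  have hDD (w : L) : T.theta (T.D (T.D w)) = T.D (T.D (T.theta w)) := by
    simp [T.Dtheta]
  have hD (w : L) : T.B y (T.D w) = 0 := by
    have := T.Danti y w
    rw [hy.2] at this
    simpa using this.symm
  have hθ : T.B y (T.theta z) = T.B y z := by
    simpa [hy.1] using T.thetaIso y z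
  have hp := h (z + T.theta z + T.D (T.D (z + T.theta z))) <| by
    rw [mem_gPlusUp]
    refine ⟨?_, by rw [map_add, T.D3, add_neg_cancel]⟩
    simp only [map_add, hDD, T.thetaInvol]
    abel
  rw [map_add, hD, map_add, hθ] at hp
  linarith

section OrthonormalBasis

variable {n : ℕ} {e : Fin n → L} {κ : Fin n → ℝ}

theorem eq_sum_of_mem_span (horth : ∀ i j, i ≠ j → T.B (e i) (e j) = 0)
    (hκ : ∀ j, T.B (e j) (e j) = κ j) (hκ1 : ∀ j, κ j = 1 ∨ κ j = -1) {v : L}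
    (hv : v ∈ Submodule.span ℝ (Set.range e)) :
    v = ∑ i, (κ i * T.B (e i) v) • e i := by
  induction hv using Submodule.span_induction with
  | mem x hx =>
    obtain ⟨j, rfl⟩ := hx
    rw [Finset.sum_eq_single j (fun i _ hij => by simp [horth i j hij]) (by simp), hκ]
    rcases hκ1 j with hj | hj <;> simp [hj]
  | zero => simp
  | add x y _ _ hx hy =>
    simp only [map_add, mul_add, add_smul, Finset.sum_add_distrib]
    rw [← hx, ← hy]
  | smul a x _ hx =>
    simp only [map_smul, smul_eq_mul, mul_left_comm _ a, mul_smul a, ← Finset.smul_sum]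
    rw [← hx]

/-- The unnormalised mean curvature vector is centralised by `g₊⁺`. -/
theorem lie_sum_lie_D_self_eq_zero (hmem : ∀ j, e j ∈ T.gMinusDown)
    (hspan : ∀ x ∈ T.gMinusDown, x ∈ Submodule.span ℝ (Set.range e))
    (horth : ∀ i j, i ≠ j → T.B (e i) (e j) = 0)
    (hκ : ∀ j, T.B (e j) (e j) = κ j) (hκ1 : ∀ j, κ j = 1 ∨ κ j = -1)
    {x : L} (hx : x ∈ T.gPlusUp) :
    ⁅x, ∑ j, κ j • ⁅T.D (e j), e j⁆⁆ = 0 := by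
  have hexp (j : Fin n) : ⁅x, e j⁆ = ∑ i, (κ i * T.B (e i) ⁅x, e j⁆) • e i :=
    T.eq_sum_of_mem_span horth hκ hκ1 (hspan _ (T.lie_mem_gMinusDown hx (hmem j)))
  have hanti (i j : Fin n) : T.B (e i) ⁅x, e j⁆ = -T.B (e j) ⁅x, e i⁆ := by
    rw [← T.Binv, T.Bsymm, ← lie_skew, map_neg]
  have hterm (j : Fin n) : ⁅x, κ j • ⁅T.D (e j), e j⁆⁆ =
      ∑ i, (κ j * κ i * T.B (e i) ⁅x, e j⁆) • (⁅T.D (e i), e j⁆ + ⁅T.D (e j), e i⁆) := by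
    rw [lie_smul, leibniz_lie, ← T.D_lie_of_D_eq_zero (T.mem_gPlusUp.1 hx).2]
    nth_rw 1 2 [hexp j]
    simp only [map_sum, map_smul, lie_sum, sum_lie, lie_smul, smul_lie,
      ← Finset.sum_add_distrib, ← smul_add, Finset.smul_sum, smul_smul, mul_assoc]
  rw [lie_sum]
  simp only [hterm]
  have : IsAddTorsionFree L := .of_isTorsionFree ℝ L
  rw [← self_eq_neg]
  conv_lhs => rw [Finset.sum_comm]
  simp only [← Finset.sum_neg_distrib]
  refine Finset.sum_congr rfl fun i _ => Finset.sum_congr rfl fun j _ => ?_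
  rw [hanti i j, add_comm, mul_comm (κ j), mul_neg, neg_smul]

end OrthonormalBasis

end ExtSymTriple

/-- For an extrinsic symmetric triple, the shape operators `A_h` and `A_η` (`A_η u = -⁅Du, η⁆`)
commute on `g₋⁻` for every `η ∈ g₋⁺`: note `A_h (A_η u) = ⁅D ⁅Du, η⁆, h⁆` and
`A_η (A_h u) = ⁅D ⁅Du, h⁆, η⁆`. -/
theorem shape_commute
    {L : Type} [LieRing L] [LieAlgebra ℝ L] [Module.Finite ℝ L]
    (T : ExtSymTriple L)
    (n : ℕ) (hn : 1 ≤ n) (hdim : n = Module.finrank ℝ T.gMinusDown)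
    (e : Fin n → L) (hmem : ∀ j, e j ∈ T.gMinusDown)
    (hspan : ∀ x ∈ T.gMinusDown, x ∈ Submodule.span ℝ (Set.range e))
    (horth : ∀ i j, i ≠ j → T.B (e i) (e j) = 0)
    (κ : Fin n → ℝ) (hκ : ∀ j, T.B (e j) (e j) = κ j) (hκ1 : ∀ j, κ j = 1 ∨ κ j = -1)
    (h : L) (hh : h = (n : ℝ)⁻¹ • ∑ j, κ j • ⁅T.D (e j), e j⁆) :
    ∀ η ∈ T.gMinusUp, ∀ u ∈ T.gMinusDown,
      ⁅T.D ⁅T.D u, η⁆, h⁆ = ⁅T.D ⁅T.D u, h⁆, η⁆ := by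
  intro η hη u hu
  have hhUp : h ∈ T.gMinusUp := by
    rw [hh]
    exact Submodule.smul_mem _ _ <| Submodule.sum_mem _ fun j _ =>
      Submodule.smul_mem _ _ (T.lie_D_self_mem_gMinusUp (hmem j))
  have hinv : ∀ x ∈ T.gPlusUp, ⁅x, h⁆ = 0 := fun x hx => by
    rw [hh, lie_smul, T.lie_sum_lie_D_self_eq_zero hmem hspan horth hκ hκ1 hx, smul_zero]
  have hcomm : ⁅η, h⁆ = 0 :=
    T.eq_zero_of_orthogonal_gPlusUp (T.lie_mem_gPlusUp hη hhUp) fun x hx => by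
      rw [T.Binv, ← lie_skew, hinv x hx, neg_zero, map_zero]
  have hD {v : L} (hv : v ∈ T.gMinusUp) : T.D ⁅T.D u, v⁆ = -⁅u, v⁆ := by
    rw [T.Dder, (T.mem_gMinusUp.1 hv).2, (T.mem_gMinusDown.1 hu).2, neg_lie, lie_zero, add_zero]
  rw [hD hη, hD hhUp, neg_lie, neg_lie, lie_lie u η h, hcomm, lie_zero, zero_sub, neg_neg, lie_skew]
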